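/- arXiv:1307.3602 — 3 statements merged into one kernel-verified Lean document; each statement's English description precedes it below -/
import Mathlib

section
/- Let L be a first-order language and let M be a substructure of an L-structure N. If M is existentially closed in N (that is, every existential formula with parameters from M that holds in N already holds in M), then there is an L-structure M⁺ and embeddings making M ⊆ N ⊆ M⁺ a chain of substructures such that M is an elementary substructure of M⁺. -/
open FirstOrder Language

universe u

namespace Paper

/-- `M` is existentially closed in `N` (via the embedding `f`): every existential formula
(of the form `∃ x̄ ψ` with `ψ` quantifier-free) with parameters from `M` that holds in `N`
already holds in `M`. -/
def ExistClosedIn {L : FirstOrder.Language.{u, u}} {M N : Type u} [L.Structure M]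
    [L.Structure N] (f : M ↪[L] N) : Prop :=
  ∀ (m n : ℕ) (ψ : L.BoundedFormula (Fin m) n), ψ.IsQF →
    ∀ a : Fin m → M, ψ.exs.Realize (f ∘ a) → ψ.exs.Realize a

/-- Restricting the free variables of a quantifier-free formula keeps it quantifier-free. -/
theorem isQF_restrictFreeVar {L : FirstOrder.Language.{u, u}} {α β : Type*} [DecidableEq α] {n : ℕ}
    {φ : L.BoundedFormula α n} (h : φ.IsQF) :
    ∀ g : φ.freeVarFinset → β, (φ.restrictFreeVar g).IsQF := by
  induction h with
  | falsum => exact fun _ => .falsum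
  | of_isAtomic h =>
    cases h with
    | equal => exact fun _ => .of_isAtomic (.equal _ _)
    | rel => exact fun _ => .of_isAtomic (.rel _ _)
  | imp _ _ ih₁ ih₂ => exact fun _ => (ih₁ _).imp (ih₂ _)

/-- If `M` is existentially closed in a nonempty `N`, then `M` is nonempty. -/
theorem ExistClosedIn.nonempty {L : FirstOrder.Language.{u, u}} {M N : Type u} [L.Structure M]
    [L.Structure N] {f : M ↪[L] N} (hec : ExistClosedIn f) [Nonempty N] : Nonempty M := by
  have h := hec 0 1 ⊤ .top Fin.elim0
    (BoundedFormula.realize_exs.2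
      ⟨fun _ => Classical.arbitrary N, BoundedFormula.realize_top.2 trivial⟩)
  obtain ⟨xs, -⟩ := BoundedFormula.realize_exs.1 h
  exact ⟨xs 0⟩

/-- If `M` is existentially closed in `N`, then any quantifier-free formula with variables named by
the elements of `N` that is true in `N` is realized in `M` by a retraction of `f`. -/
theorem ExistClosedIn.exists_leftInverse_realize {L : FirstOrder.Language.{u, u}} {M N : Type u}
    [L.Structure M] [L.Structure N] {f : M ↪[L] N} (hec : ExistClosedIn f) [Nonempty N]
    {φ : L.Formula N} (hφ : φ.IsQF) (h : φ.Realize id) :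
    ∃ v : N → M, Function.LeftInverse v f ∧ φ.Realize v := by
  classical
  have := hec.nonempty
  let p : φ.freeVarFinset → Prop := fun x => x.1 ∈ Set.range f
  let e₁ := Fintype.equivFin {x // p x}
  let e₂ := Fintype.equivFin {x // ¬ p x}
  let G : φ.freeVarFinset ≃ _ ⊕ _ := (Equiv.sumCompl p).symm.trans (e₁.sumCongr e₂)
  let r : N → M := Function.invFun f
  let ψ := BoundedFormula.relabel (k := 0) id (φ.restrictFreeVar G)
  let a := fun i => r (e₁.symm i).1.1
  have hr : ∀ x, r (f x) = x := Function.leftInverse_invFun f.injective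
  have hG₁ (x) (hx : p x) : G x = Sum.inl (e₁ ⟨x, hx⟩) := by
    simp [G, Equiv.sumCompl_symm_apply_of_pos hx]
  have hG₂ (x) (hx : ¬ p x) : G x = Sum.inr (e₂ ⟨x, hx⟩) := by
    simp [G, Equiv.sumCompl_symm_apply_of_neg hx]
  have hN : ψ.exs.Realize (f ∘ a) := by
    refine BoundedFormula.realize_exs.2 ⟨fun i => (e₂.symm i).1.1, ?_⟩
    refine BoundedFormula.realize_relabel.2 ((BoundedFormula.realize_restrictFreeVar id ?_).2 ?_)
    · intro x
      by_cases hx : p x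
      · obtain ⟨y, hy⟩ := id hx
        simp [hG₁ x hx, a, ← hy, hr]
      · simp [hG₂ x hx]
    · rwa [Formula.Realize, Subsingleton.elim default] at h
  obtain ⟨ys, hys⟩ := BoundedFormula.realize_exs.1 (hec _ _ ψ
    ((isQF_restrictFreeVar hφ _).relabel _) a hN)
  let v : N → M := fun x =>
    if hx : x ∈ φ.freeVarFinset ∧ x ∉ Set.range f then ys (e₂ ⟨⟨x, hx.1⟩, hx.2⟩) else r x
  refine ⟨v, fun x => by simp [v, hr], ?_⟩
  have := (BoundedFormula.realize_restrictFreeVar v ?_).1 (BoundedFormula.realize_relabel.1 hys)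
  · rwa [Formula.Realize, Subsingleton.elim default]
  · intro x
    by_cases hx : p x
    · have hx' : ¬ (x.1 ∈ φ.freeVarFinset ∧ x.1 ∉ Set.range f) := fun h => h.2 hx
      simp only [v, dif_neg hx']
      simp [hG₁ x hx, a]
    · have hx' : x.1 ∈ φ.freeVarFinset ∧ x.1 ∉ Set.range f := ⟨x.2, hx⟩
      simp only [v, dif_pos hx']
      simp [hG₂ x hx]

/-- If `M` is existentially closed in `N`, there is an ultrafilter on the maps `N → M` concentrating
on the retractions of `f` and on the realizations of each quantifier-free formula true in `N`. -/
theorem ExistClosedIn.exists_ultrafilter {L : FirstOrder.Language.{u, u}} {M N : Type u}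
    [L.Structure M] [L.Structure N] {f : M ↪[L] N} (hec : ExistClosedIn f) [Nonempty N] :
    ∃ U : Ultrafilter (N → M), (∀ᶠ v in U, Function.LeftInverse v f) ∧
      ∀ φ : L.Formula N, φ.IsQF → φ.Realize id → ∀ᶠ v : N → M in U, φ.Realize v := by
  let I := {φ : L.Formula N // φ.IsQF ∧ φ.Realize id}
  let S : I → Set (N → M) := fun φ => {v | Function.LeftInverse v f ∧ φ.1.Realize v}
  have hI : Nonempty I := ⟨⟨⊤, .top, Formula.realize_top.2 trivial⟩⟩
  have : (⨅ φ, Filter.principal (S φ)).NeBot := by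
    refine Filter.iInf_neBot_of_directed' (fun φ ψ => ?_) fun φ =>
      Filter.principal_neBot_iff.2 (hec.exists_leftInverse_realize φ.2.1 φ.2.2)
    refine ⟨⟨φ.1 ⊓ ψ.1, φ.2.1.inf ψ.2.1, Formula.realize_inf.2 ⟨φ.2.2, ψ.2.2⟩⟩, ?_, ?_⟩
    · exact Filter.principal_mono.2 fun v hv => ⟨hv.1, (Formula.realize_inf.1 hv.2).1⟩
    · exact Filter.principal_mono.2 fun v hv => ⟨hv.1, (Formula.realize_inf.1 hv.2).2⟩
  have hmem (φ : I) : ∀ᶠ v in Ultrafilter.of (⨅ φ, Filter.principal (S φ)), v ∈ S φ :=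
    Ultrafilter.of_le _ (Filter.mem_iInf_of_mem φ (Filter.mem_principal_self _))
  exact ⟨_, (hmem hI.some).mono fun v hv => hv.1,
    fun φ hφ h => (hmem ⟨φ, hφ, h⟩).mono fun v hv => hv.2⟩

/-- A map that preserves the truth of all quantifier-free formulas is an embedding. -/
def embeddingOfRealizeQF {L : FirstOrder.Language.{u, u}} {N P : Type*} [L.Structure N]
    [L.Structure P] (g : N → P)
    (hg : ∀ φ : L.Formula N, φ.IsQF → (φ.Realize g ↔ φ.Realize id)) : N ↪[L] P where
  toFun := g
  inj' x y hxy := by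
    simpa using (hg (Term.equal (.var x) (.var y)) (.of_isAtomic (.equal _ _))).1
      (by simpa using hxy)
  map_fun' {n} F x := by
    have := (hg (Term.equal (.var (Structure.funMap F x)) (.func F fun i => .var (x i)))
      (.of_isAtomic (.equal _ _))).2 (by simp)
    simpa [Function.comp_def] using this
  map_rel' {n} R x := by
    simpa [Formula.realize_rel, Function.comp_def] using
      hg (R.formula fun i => .var (x i)) (.of_isAtomic (.rel _ _))

/-- If `M` is a substructure of `N` (witnessed by the embedding `f`) that is existentially
closed in `N`, then there is a further extension `M ⊆ N ⊆ M⁺` (witnessed by an embedding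
`g : N ↪ M⁺`) such that the composite inclusion `M ⊆ M⁺` is elementary. -/
theorem existentiallyClosed_implies_resurrection
    {L : FirstOrder.Language.{u, u}} {M N : Type u} [L.Structure M] [L.Structure N]
    (f : M ↪[L] N) (hec : ExistClosedIn f) :
    ∃ (P : Type u) (iP : L.Structure P)
      (g : @FirstOrder.Language.Embedding L N P _ iP)
      (e : @FirstOrder.Language.ElementaryEmbedding L M P _ iP),
      ∀ x : M, e.toFun x = g.toFun (f x) := by
  cases isEmpty_or_nonempty N with
  | inl hN =>
    have hf : Function.Surjective f := fun y => isEmptyElim y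
    let F : M ≃[L] N :=
      { Equiv.ofBijective f ⟨f.injective, hf⟩ with
        map_fun' := f.map_fun'
        map_rel' := f.map_rel' }
    exact ⟨N, inferInstance, .refl L N, F.toElementaryEmbedding, fun _ => rfl⟩
  | inr hN =>
    have := hec.nonempty
    obtain ⟨U, hUf, hU⟩ := hec.exists_ultrafilter
    let P := (U : Filter (N → M)).Product fun _ => M
    let g : N → P := fun x => ((fun v : N → M => v x) : P)
    have hg (φ : L.Formula N) (hφ : φ.IsQF) : φ.Realize g ↔ φ.Realize id := by
      refine (Ultraproduct.realize_formula_cast (u := U) φ fun x (v : N → M) => v x).trans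
        ⟨fun h => ?_, hU φ hφ⟩
      by_contra hn
      obtain ⟨v, hv, hv'⟩ := (h.and (hU φ.not hφ.not (Formula.realize_not.2 hn))).exists
      exact Formula.realize_not.1 hv' hv
    let e : M ↪ₑ[L] P :=
      { toFun := fun x => ((fun _ : N → M => x) : P)
        map_formula' := fun n φ x =>
          (Ultraproduct.realize_formula_cast φ fun i _ => x i).trans Filter.eventually_const }
    exact ⟨P, inferInstance, embeddingOfRealizeQF g hg, e,
      fun x => Quotient.sound (hUf.mono fun v hv => (hv x).symm)⟩

end Paper
end

section
/- If δ is a Mahlo cardinal, then the uplifting cardinals of V_δ form a proper class of V_δ: for every ordinal θ < δ there is a cardinal κ with θ < κ < δ such that κ is inaccessible and for every ordinal θ' < δ there is an inaccessible cardinal γ with θ' ≤ γ < δ, κ < γ, and V_κ ≺ V_γ. -/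
open FirstOrder Language

universe u

namespace Paper

/-- The language of set theory: a single binary relation symbol (membership).
We reuse `FirstOrder.Language.graph`, whose sole symbol is a binary relation. -/
abbrev LSet : FirstOrder.Language := FirstOrder.Language.graph

/-- The rank-initial segment `V_α` of the cumulative hierarchy, realized as the
collection of ZF sets of rank less than `α`. -/
abbrev Vt (α : Ordinal) : Type 1 := {x : ZFSet // x.rank < α}

/-- `V_α` as a structure in the language of set theory, with the membership relation. -/
instance VtStructure (α : Ordinal) : LSet.Structure (Vt α) where
  funMap := fun f _ => f.elim
  RelMap := fun r x => match r with | .adj => (x 0).1 ∈ (x 1).1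

/-- The universe of sets as a structure in the language of set theory. -/
instance ZFSetStructure : LSet.Structure ZFSet where
  funMap := fun f _ => f.elim
  RelMap := fun r x => match r with | .adj => x 0 ∈ x 1

/-- `V_α ≺ V_β`: the inclusion of `V_α` into `V_β` is an elementary embedding. -/
def VElem (α β : Ordinal) : Prop :=
  ∃ e : Vt α ↪ₑ[LSet] Vt β, ∀ x : Vt α, (e x : ZFSet) = x

/-- An ordinal which is a cardinal. -/
def IsCardOrd (γ : Ordinal) : Prop := γ.card.ord = γ

/-- An ordinal which is a regular cardinal. -/
def IsRegularOrd (γ : Ordinal) : Prop := γ.card.IsRegular ∧ γ.card.ord = γ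

/-- An ordinal which is an inaccessible cardinal (uncountable, regular, strong limit). -/
def IsInaccOrd (γ : Ordinal) : Prop := γ.card.IsInaccessible ∧ γ.card.ord = γ

/-- An inaccessible cardinal `κ` is uplifting if for every ordinal `θ` there is an
inaccessible cardinal `γ ≥ θ` such that `V_κ ≺ V_γ` is a proper elementary extension. -/
def IsUplifting (κ : Ordinal) : Prop :=
  IsInaccOrd κ ∧ ∀ θ : Ordinal, ∃ γ : Ordinal, IsInaccOrd γ ∧ θ ≤ γ ∧ κ < γ ∧ VElem κ γ

/-- An inaccessible cardinal `κ` is pseudo uplifting if for every ordinal `θ` there is a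
cardinal `γ ≥ θ` such that `V_κ ≺ V_γ` is a proper elementary extension. -/
def IsPseudoUplifting (κ : Ordinal) : Prop :=
  IsInaccOrd κ ∧ ∀ θ : Ordinal, ∃ γ : Ordinal, IsCardOrd γ ∧ θ ≤ γ ∧ κ < γ ∧ VElem κ γ

/-- `C` is closed and unbounded in `δ`. -/
def IsClubIn (C : Set Ordinal) (δ : Ordinal) : Prop :=
  C ⊆ Set.Iio δ ∧
  (∀ α < δ, ∃ β ∈ C, α < β) ∧
  (∀ α : Ordinal, 0 < α → α < δ → (∀ β < α, ∃ γ ∈ C, β < γ ∧ γ < α) → α ∈ C)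

/-- `δ` is a Mahlo cardinal: `δ` is inaccessible and every closed unbounded subset of `δ`
contains an inaccessible cardinal. -/
def IsMahloOrd (δ : Ordinal) : Prop :=
  IsInaccOrd δ ∧ ∀ C : Set Ordinal, IsClubIn C δ → ∃ κ ∈ C, IsInaccOrd κ

section

open Cardinal

/-- The set of ranks below `α` is closed under Tarski–Vaught witnesses for `V_δ`. -/
def WitnessClosed (α δ : Ordinal) : Prop :=
  ∀ (n : ℕ) (φ : LSet.BoundedFormula Empty (n + 1)) (v : Fin n → Vt δ),
    (∀ i, (v i).1.rank < α) → ∀ a : Vt δ, φ.Realize default (Fin.snoc v a : _ → Vt δ) →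
      ∃ b : Vt δ, b.1.rank < α ∧ φ.Realize default (Fin.snoc v b : _ → Vt δ)

/-- The inclusion of `V_α` into `V_β` as an embedding of structures. -/
def inclusionEmbedding {α β : Ordinal} (h : α ≤ β) : Vt α ↪[LSet] Vt β where
  toFun x := ⟨x.1, x.2.trans_le h⟩
  inj' _ _ hxy := Subtype.ext (Subtype.mk.inj hxy)
  map_fun' f := f.elim
  map_rel' r _ := by cases r; rfl

theorem WitnessClosed.velem {α δ : Ordinal} (h : WitnessClosed α δ) (hα : α ≤ δ) :
    VElem α δ := by
  refine ⟨(inclusionEmbedding hα).toElementaryEmbedding fun n φ v a ha ↦ ?_, fun _ ↦ rfl⟩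
  obtain ⟨b, hb, hφ⟩ := h n φ (inclusionEmbedding hα ∘ v) (fun i ↦ (v i).2) a ha
  exact ⟨⟨b.1, hb⟩, hφ⟩

theorem VElem.of_common_extension {κ γ δ : Ordinal} (hκγ : κ ≤ γ) (hκ : VElem κ δ)
    (hγ : VElem γ δ) : VElem κ γ := by
  obtain ⟨e, he⟩ := hκ
  obtain ⟨g, hg⟩ := hγ
  refine ⟨⟨fun x ↦ ⟨x.1, x.2.trans_le hκγ⟩, fun n φ v ↦ ?_⟩, fun _ ↦ rfl⟩
  rw [← e.map_formula, ← g.map_formula]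
  have hcomp : g ∘ (fun x : Vt κ ↦ (⟨x.1, x.2.trans_le hκγ⟩ : Vt γ)) ∘ v = e ∘ v :=
    funext fun i ↦ Subtype.ext ((hg _).trans (he _).symm)
  rw [hcomp]

theorem IsInaccOrd.mk_vt_lt {β δ : Ordinal.{0}} (hδ : IsInaccOrd δ) (hβ : β < δ) :
    #(Vt β) < lift.{1} δ.card := by
  have hcard : #(Vt β) = #(ZFSet.vonNeumann β) :=
    Cardinal.mk_congr (Equiv.subtypeEquivRight fun _ ↦ ZFSet.mem_vonNeumann.symm)
  rw [hcard, ZFSet.cardinalMk_coe_sort, ZFSet.card_vonNeumann, Cardinal.lift_lt,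
    ← hδ.1.preBeth_ord, hδ.2]
  exact Cardinal.preBeth_strictMono hβ

instance : Countable (Σ l, LSet.Functions l) := by
  have : IsEmpty (Σ l, LSet.Functions l) := ⟨fun f ↦ f.2.elim⟩
  infer_instance

instance : Countable (Σ l, LSet.Relations l) :=
  Function.Injective.countable (f := Sigma.fst) fun ⟨_, r⟩ ⟨_, s⟩ h ↦ by
    cases r; cases s; rfl

/-- The formulas with parameters in `V_β` and one distinguished free variable. -/
abbrev ParamFormula (β : Ordinal) : Type 1 :=
  Σ p : (Σ n, LSet.BoundedFormula Empty (n + 1)), Fin p.1 → Vt β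

theorem IsInaccOrd.mk_paramFormula_lt {β δ : Ordinal.{0}} (hδ : IsInaccOrd δ) (hβ : β < δ) :
    #(ParamFormula β) < lift.{1} δ.card := by
  have hcount : Countable (Σ n, LSet.BoundedFormula Empty (n + 1)) :=
    Function.Injective.countable
      (f := fun p ↦ (⟨p.1 + 1, p.2⟩ : Σ n, LSet.BoundedFormula Empty n)) <| by
        rintro ⟨n, φ⟩ ⟨m, ψ⟩ h
        obtain ⟨h₁, h₂⟩ := Sigma.mk.inj_iff.1 h
        obtain rfl := Nat.succ.inj h₁
        exact congrArg (Sigma.mk n) (eq_of_heq h₂)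
  have hℵ : ℵ₀ < lift.{1} δ.card := Cardinal.aleph0_lt_lift.2 hδ.1.aleph0_lt
  rw [Cardinal.mk_sigma]
  refine Cardinal.sum_lt_lift_of_isRegular hδ.1.isRegular.lift ?_ fun p ↦ ?_
  · exact (by simp : lift.{1} #(Σ n, LSet.BoundedFormula Empty (n + 1)) ≤ ℵ₀).trans_lt hℵ
  · rw [Cardinal.mk_arrow]
    refine lt_of_le_of_lt ?_ (max_lt (hδ.mk_vt_lt hβ) hℵ)
    simpa using Cardinal.power_nat_le_max (c := #(Vt β)) (n := p.1)

/-- Witnesses for formulas with parameters in `V_β` can be found at bounded rank below `δ`. -/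
theorem IsInaccOrd.exists_witness_bound {β δ : Ordinal.{0}} (hδ : IsInaccOrd δ) (hβ : β < δ) :
    ∃ ρ < δ, ∀ (n : ℕ) (φ : LSet.BoundedFormula Empty (n + 1)) (v : Fin n → Vt δ),
      (∀ i, (v i).1.rank < β) → ∀ a : Vt δ, φ.Realize default (Fin.snoc v a : _ → Vt δ) →
        ∃ b : Vt δ, b.1.rank < ρ ∧ φ.Realize default (Fin.snoc v b : _ → Vt δ) := by
  have hlim : Order.IsSuccLimit δ := by
    rw [← hδ.2]
    exact Cardinal.isSuccLimit_ord hδ.1.aleph0_lt.le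
  have hex (p : ParamFormula β) : ∃ r < δ, ∀ a : Vt δ,
      p.1.2.Realize default (Fin.snoc (inclusionEmbedding hβ.le ∘ p.2) a : _ → Vt δ) →
        ∃ b : Vt δ, b.1.rank < r ∧
          p.1.2.Realize default (Fin.snoc (inclusionEmbedding hβ.le ∘ p.2) b : _ → Vt δ) := by
    by_cases hp : ∃ b : Vt δ,
        p.1.2.Realize default (Fin.snoc (inclusionEmbedding hβ.le ∘ p.2) b : _ → Vt δ)
    · obtain ⟨b, hb⟩ := hp
      exact ⟨b.1.rank + 1, hlim.add_one_lt b.2, fun _ _ ↦ ⟨b, Order.lt_add_one_iff.2 le_rfl, hb⟩⟩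
    · exact ⟨0, hlim.bot_lt, fun a ha ↦ (hp ⟨a, ha⟩).elim⟩
  choose r hr hw using hex
  have hsmall : Small.{0} (ParamFormula β) :=
    Cardinal.small_iff_lift_mk_lt_univ.2 <| by
      simpa using (hδ.mk_paramFormula_lt hβ).trans (Cardinal.lift_lt_univ _)
  refine ⟨⨆ p, r p, Ordinal.lift_iSup_lt_of_lt_cof ?_ hr, fun n φ v hv a ha ↦ ?_⟩
  · have hcof : (Ordinal.lift.{1} δ).cof = lift.{1} δ.card := by
      rw [← hδ.1.isRegular.lift.cof_ord, ← Cardinal.lift_ord, hδ.2]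
    simpa [hcof] using hδ.mk_paramFormula_lt hβ
  · obtain ⟨b, hb, hφ⟩ := hw ⟨⟨n, φ⟩, fun i ↦ ⟨(v i).1, hv i⟩⟩ a ha
    exact ⟨b, hb.trans_le (Ordinal.le_iSup r _), hφ⟩

theorem IsInaccOrd.exists_witnessClosed {θ δ : Ordinal.{0}} (hδ : IsInaccOrd δ) (hθ : θ < δ) :
    ∃ α, θ < α ∧ α < δ ∧ WitnessClosed α δ := by
  have hlim : Order.IsSuccLimit δ := by
    rw [← hδ.2]
    exact Cardinal.isSuccLimit_ord hδ.1.aleph0_lt.le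
  have hex (β : Ordinal) : ∃ ρ, β < ρ ∧ (β < δ → ρ < δ ∧
      ∀ (n : ℕ) (φ : LSet.BoundedFormula Empty (n + 1)) (v : Fin n → Vt δ),
        (∀ i, (v i).1.rank < β) → ∀ a : Vt δ, φ.Realize default (Fin.snoc v a : _ → Vt δ) →
          ∃ b : Vt δ, b.1.rank < ρ ∧ φ.Realize default (Fin.snoc v b : _ → Vt δ)) := by
    by_cases hβ : β < δ
    · obtain ⟨ρ, hρ, hw⟩ := hδ.exists_witness_bound hβ
      refine ⟨max ρ (β + 1), lt_max_of_lt_right (Order.lt_add_one_iff.2 le_rfl), fun _ ↦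
        ⟨max_lt hρ (hlim.add_one_lt hβ), fun n φ v hv a ha ↦ ?_⟩⟩
      obtain ⟨b, hb, hφ⟩ := hw n φ v hv a ha
      exact ⟨b, lt_max_of_lt_left hb, hφ⟩
    · exact ⟨β + 1, Order.lt_add_one_iff.2 le_rfl, fun h ↦ (hβ h).elim⟩
  choose f hf hfδ using hex
  have hmono : Monotone fun n ↦ f^[n] θ := monotone_nat_of_le_succ fun n ↦ by
    rw [Function.iterate_succ_apply']
    exact (hf _).le
  have hnfp : Ordinal.nfp f θ < δ := by
    have hlt := Cardinal.nfp_lt_ord_of_isRegular (f := f) (a := θ) hδ.1.isRegular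
      hδ.1.aleph0_lt.ne'
    rw [hδ.2] at hlt
    exact hlt (fun β hβ ↦ (hfδ β hβ).1) hθ
  refine ⟨Ordinal.nfp f θ, (hf θ).trans_le (Ordinal.iterate_le_nfp f θ 1), hnfp,
    fun n φ v hv a ha ↦ ?_⟩
  have hev : ∀ᶠ N in Filter.atTop, ∀ i, (v i).1.rank < f^[N] θ := by
    refine Filter.eventually_all.2 fun i ↦ ?_
    obtain ⟨N, hN⟩ := Ordinal.lt_nfp_iff.1 (hv i)
    filter_upwards [Filter.eventually_ge_atTop N] with M hM using hN.trans_le (hmono hM)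
  obtain ⟨N, hN⟩ := hev.exists
  obtain ⟨b, hb, hφ⟩ :=
    (hfδ _ ((Ordinal.iterate_le_nfp f θ N).trans_lt hnfp)).2 n φ v hN a ha
  rw [← Function.iterate_succ_apply' f] at hb
  exact ⟨b, hb.trans_le (Ordinal.iterate_le_nfp f θ _), hφ⟩

theorem WitnessClosed.of_cofinal {α δ : Ordinal} (hα : 0 < α)
    (h : ∀ β < α, ∃ γ, WitnessClosed γ δ ∧ β < γ ∧ γ < α) : WitnessClosed α δ := by
  intro n φ v hv a ha
  obtain ⟨γ, hγ, hβγ, hγα⟩ := h (Finset.univ.sup fun i ↦ (v i).1.rank)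
    ((Finset.sup_lt_iff hα).2 fun i _ ↦ hv i)
  obtain ⟨b, hb, hφ⟩ := hγ n φ v
    (fun i ↦ (Finset.le_sup (f := fun i ↦ (v i).1.rank) (Finset.mem_univ i)).trans_lt hβγ) a ha
  exact ⟨b, hb.trans hγα, hφ⟩

theorem IsInaccOrd.isClubIn_witnessClosed {θ δ : Ordinal.{0}} (hδ : IsInaccOrd δ)
    (hθ : θ < δ) : IsClubIn {α | θ < α ∧ α < δ ∧ WitnessClosed α δ} δ := by
  refine ⟨fun α hα ↦ hα.2.1, fun α hα ↦ ?_, fun α hα hαδ hcof ↦ ?_⟩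
  · obtain ⟨β, hβ, hβδ, hw⟩ := hδ.exists_witnessClosed (max_lt hα hθ)
    exact ⟨β, ⟨(le_max_right _ _).trans_lt hβ, hβδ, hw⟩, (le_max_left _ _).trans_lt hβ⟩
  · obtain ⟨γ, hγ, -, hγα⟩ := hcof 0 hα
    refine ⟨hγ.1.trans hγα, hαδ, .of_cofinal hα fun β hβ ↦ ?_⟩
    obtain ⟨γ, hγ, hβγ, hγα⟩ := hcof β hβ
    exact ⟨γ, hγ.2.2, hβγ, hγα⟩

theorem IsMahloOrd.exists_isInaccOrd_velem {θ δ : Ordinal.{0}} (h : IsMahloOrd δ) (hθ : θ < δ) :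
    ∃ κ, θ < κ ∧ κ < δ ∧ IsInaccOrd κ ∧ VElem κ δ := by
  obtain ⟨κ, ⟨hθκ, hκδ, hw⟩, hκ⟩ := h.2 _ (h.1.isClubIn_witnessClosed hθ)
  exact ⟨κ, hθκ, hκδ, hκ, hw.velem hκδ.le⟩

end

/-- If `δ` is a Mahlo cardinal, then the uplifting cardinals of `V_δ` form a proper class
of `V_δ`: for every `θ < δ` there is an inaccessible `κ` with `θ < κ < δ` which is
uplifting in `V_δ`, i.e. for every `θ' < δ` there is an inaccessible `γ` with
`θ' ≤ γ < δ`, `κ < γ` and `V_κ ≺ V_γ`. -/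
theorem mahlo_implies_proper_class_of_uplifting (δ : Ordinal) (h : IsMahloOrd δ) :
    ∀ θ < δ, ∃ κ : Ordinal, θ < κ ∧ κ < δ ∧ IsInaccOrd κ ∧
      ∀ θ' < δ, ∃ γ : Ordinal, IsInaccOrd γ ∧ θ' ≤ γ ∧ γ < δ ∧ κ < γ ∧ VElem κ γ := by
  intro θ hθ
  obtain ⟨κ, hθκ, hκδ, hκ, hκe⟩ := h.exists_isInaccOrd_velem hθ
  refine ⟨κ, hθκ, hκδ, hκ, fun θ' hθ' ↦ ?_⟩
  obtain ⟨γ, hγ, hγδ, hγi, hγe⟩ := h.exists_isInaccOrd_velem (max_lt hθ' hκδ)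
  have hκγ := (le_max_right _ _).trans_lt hγ
  exact ⟨γ, hγi, (le_max_left _ _).trans hγ.le, hγδ, hκγ, .of_common_extension hκγ.le hκe hγe⟩

end Paper
end

section
/- If κ < γ are ordinals such that V_κ ≺ V_γ is a proper elementary extension, then both κ and γ are ℶ-fixed points; consequently V_κ = H_κ and V_γ = H_γ. In particular, if in addition κ and γ are regular cardinals, then κ and γ are inaccessible. -/
open FirstOrder Language

universe u

namespace Paper

/-- An ordinal `κ` is a ℶ-fixed point if `ℶ_κ = κ`. -/
def IsBethFixed (κ : Ordinal) : Prop := (Cardinal.beth κ).ord = κ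

/-- `H_κ`: the collection of ZF sets hereditarily of size less than `κ`, i.e. the sets
belonging to some transitive set of cardinality less than `κ`. -/
def HSet (κ : Cardinal) : Set ZFSet :=
  {x | ∃ t : ZFSet, t.IsTransitive ∧ x ∈ t ∧ Cardinal.mk.{1} t.toSet < Cardinal.lift.{1, 0} κ}

section Aux

open ZFSet Order
open scoped Ordinal Cardinal

section Formulas

variable {n : ℕ}

/-- The formula `x i ∈ x j`. -/
def memF (i j : Fin n) : LSet.BoundedFormula Empty n :=
  adj.boundedFormula₂ (&i) (&j)

/-- The formula `x i = x j`. -/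
def eqF (i j : Fin n) : LSet.BoundedFormula Empty n :=
  Term.bdEqual (&i) (&j)

/-- The formula `x i ⊆ x j`. -/
def subsetF (i j : Fin n) : LSet.BoundedFormula Empty n :=
  ((memF (Fin.last n) i.castSucc).imp (memF (Fin.last n) j.castSucc)).all

/-- The formula `x p = {x i, x j}`. -/
def unorderedPairF (p i j : Fin n) : LSet.BoundedFormula Empty n :=
  ((memF (Fin.last n) p.castSucc).iff
    (eqF (Fin.last n) i.castSucc ⊔ eqF (Fin.last n) j.castSucc)).all

/-- The formula `x p = (x i, x j)`, with Kuratowski pairs. -/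
def pairF (p i j : Fin n) : LSet.BoundedFormula Empty n :=
  ((memF (Fin.last n) p.castSucc).iff
    (unorderedPairF (Fin.last n) i.castSucc i.castSucc ⊔
      unorderedPairF (Fin.last n) i.castSucc j.castSucc)).all

/-- The formula `(x i, x j) ∈ x f`, with Kuratowski pairs. -/
def pairMemF (i j f : Fin n) : LSet.BoundedFormula Empty n :=
  (memF (Fin.last n) f.castSucc ⊓ pairF (Fin.last n) i.castSucc j.castSucc).ex

variable {α : Ordinal} {v : Empty → Vt α} {xs : Fin n → Vt α}

@[simp]
theorem realize_memF {i j : Fin n} : (memF i j).Realize v xs ↔ (xs i).1 ∈ (xs j).1 := by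
  rw [memF, BoundedFormula.realize_rel₂]
  rfl

@[simp]
theorem realize_eqF {i j : Fin n} : (eqF i j).Realize v xs ↔ (xs i).1 = (xs j).1 := by
  simp [eqF, Subtype.ext_iff]

@[simp]
theorem realize_subsetF {i j : Fin n} :
    (subsetF i j).Realize v xs ↔ (xs i).1 ⊆ (xs j).1 := by
  simp only [subsetF, BoundedFormula.realize_all, BoundedFormula.realize_imp, realize_memF,
    Fin.snoc_last, Fin.snoc_castSucc, Subtype.forall]
  exact ⟨fun h z hz ↦ h z ((rank_lt_of_mem hz).trans (xs i).2) hz, fun h z _ hz ↦ h hz⟩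

@[simp]
theorem realize_unorderedPairF {p i j : Fin n} :
    (unorderedPairF p i j).Realize v xs ↔ (xs p).1 = {(xs i).1, (xs j).1} := by
  simp only [unorderedPairF, BoundedFormula.realize_all, BoundedFormula.realize_iff,
    BoundedFormula.realize_sup, realize_memF, realize_eqF, Fin.snoc_last, Fin.snoc_castSucc,
    Subtype.forall]
  refine ⟨fun h ↦ ZFSet.ext fun z ↦ ?_, fun h z _ ↦ by rw [h, mem_pair]⟩
  rw [mem_pair]
  by_cases hz : z.rank < α
  · exact h z hz
  · refine iff_of_false (fun h ↦ hz ((rank_lt_of_mem h).trans (xs p).2)) ?_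
    rintro (rfl | rfl)
    exacts [hz (xs i).2, hz (xs j).2]

theorem rank_unorderedPair_lt (hα : IsSuccPrelimit α) {x y : ZFSet} (hx : x.rank < α)
    (hy : y.rank < α) : rank {x, y} < α := by
  rw [rank_pair]
  exact max_lt (hα.succ_lt hx) (hα.succ_lt hy)

theorem rank_pair_lt (hα : IsSuccPrelimit α) {x y : ZFSet} (hx : x.rank < α)
    (hy : y.rank < α) : (pair x y).rank < α := by
  rw [pair, ← pair_eq_singleton]
  exact rank_unorderedPair_lt hα (rank_unorderedPair_lt hα hx hx) (rank_unorderedPair_lt hα hx hy)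

theorem realize_pairF (hα : IsSuccPrelimit α) {p i j : Fin n} :
    (pairF p i j).Realize v xs ↔ (xs p).1 = pair (xs i).1 (xs j).1 := by
  simp only [pairF, BoundedFormula.realize_all, BoundedFormula.realize_iff,
    BoundedFormula.realize_sup, realize_memF, realize_unorderedPairF, Fin.snoc_last,
    Fin.snoc_castSucc, Subtype.forall, pair, pair_eq_singleton]
  refine ⟨fun h ↦ ZFSet.ext fun z ↦ ?_, fun h z _ ↦ by rw [h, mem_pair]⟩
  rw [mem_pair]
  by_cases hz : z.rank < α
  · exact h z hz
  · refine iff_of_false (fun h ↦ hz ((rank_lt_of_mem h).trans (xs p).2)) ?_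
    rintro (rfl | rfl)
    · rw [← pair_eq_singleton] at hz
      exact hz (rank_unorderedPair_lt hα (xs i).2 (xs i).2)
    · exact hz (rank_unorderedPair_lt hα (xs i).2 (xs j).2)

theorem realize_pairMemF (hα : IsSuccPrelimit α) {i j f : Fin n} :
    (pairMemF i j f).Realize v xs ↔ pair (xs i).1 (xs j).1 ∈ (xs f).1 := by
  simp only [pairMemF, BoundedFormula.realize_ex, BoundedFormula.realize_inf, realize_memF,
    realize_pairF hα, Fin.snoc_last, Fin.snoc_castSucc, Subtype.exists]
  exact ⟨fun ⟨p, _, hp, h⟩ ↦ h ▸ hp, fun h ↦ ⟨_, (rank_lt_of_mem h).trans (xs f).2, h, rfl⟩⟩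

/-- The formula saying that `x 0` belongs to some set. -/
def isMemberF : LSet.BoundedFormula Empty 1 :=
  (memF 0 1).ex

/-- The sentence saying that there is a nonempty set without `∈`-maximal elements. -/
def infinityF : LSet.BoundedFormula Empty 0 :=
  ((memF 1 0).ex ⊓ ((memF 1 0).imp (memF 2 0 ⊓ memF 1 2).ex).all).ex

/-- The formula saying that some `f` relates every element of `x 0` to some set, and carries
strict inclusion to membership. -/
def chainRankedF : LSet.BoundedFormula Empty 1 :=
  (((memF 2 0).imp (pairMemF 2 3 1).ex).all ⊓
    ((pairMemF 2 3 1).imp ((pairMemF 4 5 1).imp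
      ((subsetF 2 4).imp (eqF 2 4 ⊔ memF 3 5)))).all.all.all.all).ex

/-- The formula saying that some `f` relates every element of `x 0` to some set, and sets related
to distinct elements are comparable under membership. -/
def enumerableF : LSet.BoundedFormula Empty 1 :=
  (((memF 2 0).imp (pairMemF 2 3 1).ex).all ⊓
    ((pairMemF 2 3 1).imp ((pairMemF 4 5 1).imp
      (eqF 2 4 ⊔ (memF 3 5 ⊔ memF 5 3)))).all.all.all.all).ex

theorem realize_isMemberF {xs : Fin 1 → Vt α} :
    isMemberF.Realize v xs ↔ succ (xs 0).1.rank < α := by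
  simp only [isMemberF, BoundedFormula.realize_ex, realize_memF, Subtype.exists]
  constructor
  · rintro ⟨y, hy, h⟩
    exact (succ_le_of_lt (rank_lt_of_mem h)).trans_lt hy
  · intro h
    exact ⟨{(xs 0).1}, by rwa [rank_singleton], mem_singleton.2 rfl⟩

theorem realize_infinityF {xs : Fin 0 → Vt α} :
    infinityF.Realize v xs ↔
      ∃ x : ZFSet, x.rank < α ∧ (∃ y, y ∈ x) ∧ ∀ y ∈ x, ∃ z ∈ x, y ∈ z := by
  simp only [infinityF, BoundedFormula.realize_ex, BoundedFormula.realize_inf,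
    BoundedFormula.realize_all, BoundedFormula.realize_imp, realize_memF, Subtype.exists,
    Subtype.forall, ← exists_prop]
  refine exists_congr fun x ↦ exists_congr fun hx ↦ ?_
  have hmem {y : ZFSet} (hy : y ∈ x) : y.rank < α := (rank_lt_of_mem hy).trans hx
  constructor
  · rintro ⟨⟨y, _, hy⟩, h⟩
    refine ⟨⟨y, hy⟩, fun y hy ↦ ?_⟩
    obtain ⟨z, _, hz, hyz⟩ := h y (hmem hy) hy
    exact ⟨z, hz, hyz⟩
  · rintro ⟨⟨y, hy⟩, h⟩
    refine ⟨⟨y, hmem hy, hy⟩, fun y _ hy ↦ ?_⟩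
    obtain ⟨z, hz, hyz⟩ := h y hy
    exact ⟨z, hmem hz, hz, hyz⟩

theorem rank_lt_of_pair_mem {f a b : ZFSet} (h : pair a b ∈ f) :
    a.rank < f.rank ∧ b.rank < f.rank := by
  have hab : rank {a, b} < f.rank :=
    (rank_lt_of_mem (by simp [pair] : {a, b} ∈ pair a b)).trans (rank_lt_of_mem h)
  exact ⟨(rank_lt_of_mem (mem_pair.2 (.inl rfl))).trans hab,
    (rank_lt_of_mem (mem_pair.2 (.inr rfl))).trans hab⟩

theorem realize_chainRankedF (hα : IsSuccPrelimit α) {xs : Fin 1 → Vt α} :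
    chainRankedF.Realize v xs ↔ ∃ f : ZFSet, f.rank < α ∧
      (∀ s ∈ (xs 0).1, ∃ a, pair s a ∈ f) ∧
      ∀ s a t b, pair s a ∈ f → pair t b ∈ f → s ⊆ t → s = t ∨ a ∈ b := by
  simp only [chainRankedF, BoundedFormula.realize_ex, BoundedFormula.realize_inf,
    BoundedFormula.realize_all, BoundedFormula.realize_imp, BoundedFormula.realize_sup,
    realize_memF, realize_eqF, realize_subsetF, realize_pairMemF hα, Subtype.exists,
    Subtype.forall, ← exists_prop]
  refine exists_congr fun f ↦ exists_congr fun hf ↦ ?_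
  simp only [exists_prop]
  refine and_congr ⟨fun h s hs ↦ ?_, fun h s _ hs ↦ ?_⟩ ⟨fun h s a t b hs ht ↦ ?_, ?_⟩
  · obtain ⟨a, _, ha⟩ := h s ((rank_lt_of_mem hs).trans (xs 0).2) hs
    exact ⟨a, ha⟩
  · obtain ⟨a, ha⟩ := h s hs
    exact ⟨a, ((rank_lt_of_pair_mem ha).2.trans hf), ha⟩
  · exact h s ((rank_lt_of_pair_mem hs).1.trans hf) a ((rank_lt_of_pair_mem hs).2.trans hf)
      t ((rank_lt_of_pair_mem ht).1.trans hf) b ((rank_lt_of_pair_mem ht).2.trans hf) hs ht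
  · exact fun h s _ a _ t _ b _ ↦ h s a t b

theorem realize_enumerableF (hα : IsSuccPrelimit α) {xs : Fin 1 → Vt α} :
    enumerableF.Realize v xs ↔ ∃ f : ZFSet, f.rank < α ∧
      (∀ s ∈ (xs 0).1, ∃ a, pair s a ∈ f) ∧
      ∀ s a t b, pair s a ∈ f → pair t b ∈ f → s = t ∨ a ∈ b ∨ b ∈ a := by
  simp only [enumerableF, BoundedFormula.realize_ex, BoundedFormula.realize_inf,
    BoundedFormula.realize_all, BoundedFormula.realize_imp, BoundedFormula.realize_sup,
    realize_memF, realize_eqF, realize_pairMemF hα, Subtype.exists,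
    Subtype.forall, ← exists_prop]
  refine exists_congr fun f ↦ exists_congr fun hf ↦ ?_
  simp only [exists_prop]
  refine and_congr ⟨fun h s hs ↦ ?_, fun h s _ hs ↦ ?_⟩ ⟨fun h s a t b hs ht ↦ ?_, ?_⟩
  · obtain ⟨a, _, ha⟩ := h s ((rank_lt_of_mem hs).trans (xs 0).2) hs
    exact ⟨a, ha⟩
  · obtain ⟨a, ha⟩ := h s hs
    exact ⟨a, ((rank_lt_of_pair_mem ha).2.trans hf), ha⟩
  · exact h s ((rank_lt_of_pair_mem hs).1.trans hf) a ((rank_lt_of_pair_mem hs).2.trans hf)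
      t ((rank_lt_of_pair_mem ht).1.trans hf) b ((rank_lt_of_pair_mem ht).2.trans hf) hs ht
  · exact fun h s _ a _ t _ b _ ↦ h s a t b

end Formulas

section Elementarity

variable {κ γ : Ordinal.{0}} {x : ZFSet.{0}}

theorem VElem.realize_iff (he : VElem κ γ) (hle : κ ≤ γ) {n : ℕ}
    (φ : LSet.BoundedFormula Empty n) (xs : Fin n → Vt κ) :
    φ.Realize default xs ↔
      φ.Realize default (fun i ↦ (⟨(xs i).1, (xs i).2.trans_le hle⟩ : Vt γ)) := by
  obtain ⟨e, he⟩ := he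
  rw [← e.map_boundedFormula φ default xs]
  have h : e ∘ xs = fun i ↦ (⟨(xs i).1, (xs i).2.trans_le hle⟩ : Vt γ) :=
    funext fun i ↦ Subtype.ext (he _)
  rw [h, Subsingleton.elim (e ∘ default) default]

theorem VElem.isSuccPrelimit_left (he : VElem κ γ) (hlt : κ < γ) : IsSuccPrelimit κ := by
  refine isSuccPrelimit_iff_succ_lt.2 fun a ha ↦ ?_
  have h := he.realize_iff hlt.le isMemberF
    (fun _ ↦ ⟨V_ a, by rwa [rank_vonNeumann]⟩)
  simp only [realize_isMemberF, rank_vonNeumann] at h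
  exact h.2 ((succ_le_of_lt ha).trans_lt hlt)

theorem VElem.isSuccPrelimit_right (he : VElem κ γ) (hlt : κ < γ) : IsSuccPrelimit γ := by
  have h := he.realize_iff hlt.le isMemberF.all default
  simp only [BoundedFormula.realize_all, realize_isMemberF] at h
  refine isSuccPrelimit_iff_succ_lt.2 fun a ha ↦ ?_
  have := h.1 (fun x ↦ (he.isSuccPrelimit_left hlt).succ_lt x.2)
    ⟨V_ a, by rwa [rank_vonNeumann]⟩
  simpa [Fin.snoc] using this

theorem omega0_le_rank_of_forall_exists_mem {y : ZFSet} (hy : y ∈ x)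
    (h : ∀ y ∈ x, ∃ z ∈ x, y ∈ z) : ω ≤ x.rank := by
  have hn (n : ℕ) : ∃ z ∈ x, (n : Ordinal) ≤ z.rank := by
    induction n with
    | zero => exact ⟨y, hy, by simp⟩
    | succ n ih =>
      obtain ⟨z, hz, hnz⟩ := ih
      obtain ⟨w, hw, hzw⟩ := h z hz
      exact ⟨w, hw, by simpa using hnz.trans_lt (rank_lt_of_mem hzw)⟩
  refine Ordinal.omega0_le.2 fun n ↦ ?_
  obtain ⟨z, hz, hnz⟩ := hn n
  exact hnz.trans (rank_lt_of_mem hz).le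

theorem VElem.omega0_lt (he : VElem κ γ) (hlt : κ < γ) : ω < κ := by
  have hγ : ω ≤ γ := Ordinal.omega0_le_of_isSuccLimit
    ⟨not_isMin_of_lt hlt, he.isSuccPrelimit_right hlt⟩
  have h0 : κ ≠ 0 := by
    rintro rfl
    have h := he.realize_iff hlt.le (⊤ : LSet.BoundedFormula Empty 1).ex default
    simp only [BoundedFormula.realize_ex, BoundedFormula.realize_top, exists_const_iff,
      and_true] at h
    obtain ⟨⟨x, hx⟩⟩ := h.2 ⟨⟨∅, by simpa using hlt⟩⟩
    exact not_lt_bot hx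
  have hκ : ω ≤ κ := Ordinal.omega0_le_of_isSuccLimit
    ⟨by simpa using h0, he.isSuccPrelimit_left hlt⟩
  have h := he.realize_iff hlt.le infinityF default
  simp only [realize_infinityF] at h
  obtain ⟨x, hx, ⟨y, hy⟩, hxy⟩ := h.2 ⟨V_ ω, by simpa using hκ.trans_lt hlt,
    ⟨V_ 0, vonNeumann_mem_of_lt Ordinal.omega0_pos⟩, fun y hy ↦
      ⟨V_ (succ y.rank), vonNeumann_mem_of_lt
        (Ordinal.isSuccLimit_omega0.succ_lt (mem_vonNeumann.1 hy)), mem_vonNeumann_succ y⟩⟩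
  exact (omega0_le_rank_of_forall_exists_mem hy hxy).trans_lt hx

theorem exists_injOn_Iio_of_card_le (h : κ.card ≤ x.card) :
    ∃ F : Ordinal → ZFSet, Set.InjOn F (Set.Iio κ) ∧ ∀ a < κ, F a ∈ x := by
  rw [← Cardinal.lift_le.{1}, ← Cardinal.mk_Iio_ordinal, ← cardinalMk_coe_sort] at h
  obtain ⟨e⟩ := h
  classical
  refine ⟨fun a ↦ if ha : a < κ then (e ⟨a, ha⟩).1 else ∅, fun a ha b hb hab ↦ ?_,
    fun a ha ↦ ?_⟩
  · simp only [Set.mem_Iio] at ha hb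
    simp only [ha, hb, dite_true] at hab
    exact Subtype.mk.inj (e.injective (Subtype.ext hab))
  · simp [ha]

theorem VElem.card_lt (he : VElem κ γ) (hlt : κ < γ) (hx : x.rank < κ) :
    x.card < κ.card := by
  by_contra! hcard
  obtain ⟨F, hF, hFx⟩ := exists_injOn_Iio_of_card_le hcard
  have hκ := he.isSuccPrelimit_left hlt
  have hγ := he.isSuccPrelimit_right hlt
  let s (a : Ordinal) : ZFSet := x.sep fun w ↦ ∃ b < a, F b = w
  have hs_sub (a : Ordinal) : s a ⊆ x := sep_subset
  have hs_mono {a b : Ordinal} (hab : a ≤ b) : s a ⊆ s b := by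
    intro w hw
    obtain ⟨hw, c, hc, rfl⟩ := mem_sep.1 hw
    exact mem_sep.2 ⟨hw, c, hc.trans_le hab, rfl⟩
  have hs_lt {a b : Ordinal} (ha : a < κ) (hb : b < κ) (h : s a ⊆ s b) : a ≤ b := by
    by_contra! hba
    have hmem : F b ∈ s b := h (mem_sep.2 ⟨hFx b hb, b, hba, rfl⟩)
    obtain ⟨-, c, hc, hcb⟩ := mem_sep.1 hmem
    exact hc.ne (hF (hc.trans hb) hb hcb)
  have hs_rank (a : Ordinal) : (s a).rank < κ := (rank_mono (hs_sub a)).trans_lt hx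
  let c : ZFSet := x.powerset.sep fun t ↦ ∃ a < κ, s a = t
  have hc {t : ZFSet} : t ∈ c ↔ ∃ a < κ, s a = t := by
    refine mem_sep.trans (and_iff_right_of_imp ?_)
    rintro ⟨a, -, rfl⟩
    exact mem_powerset.2 (hs_sub a)
  have hc_rank : c.rank < κ := by
    refine (rank_mono sep_subset).trans_lt ?_
    rw [rank_powerset]
    exact hκ.succ_lt hx
  let g : ZFSet := (V_ κ).sep fun p ↦ ∃ a < κ, pair (s a) (V_ a) = p
  have hg {p : ZFSet} : p ∈ g ↔ ∃ a < κ, pair (s a) (V_ a) = p := by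
    refine mem_sep.trans (and_iff_right_of_imp ?_)
    rintro ⟨a, ha, rfl⟩
    exact mem_vonNeumann.2 (rank_pair_lt hκ (hs_rank a) (by rwa [rank_vonNeumann]))
  have hg_rank : g.rank < γ := by
    refine (rank_mono sep_subset).trans_lt ?_
    rwa [rank_vonNeumann]
  have hγc : chainRankedF.Realize default fun _ ↦ (⟨c, hc_rank.trans hlt⟩ : Vt γ) := by
    refine (realize_chainRankedF hγ).2 ⟨g, hg_rank, ?_, ?_⟩
    · intro t ht
      obtain ⟨a, ha, rfl⟩ := hc.1 ht
      exact ⟨V_ a, hg.2 ⟨a, ha, rfl⟩⟩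
    · intro t v t' v' ht ht' hsub
      obtain ⟨a, ha, hat⟩ := hg.1 ht
      obtain ⟨b, hb, hbt⟩ := hg.1 ht'
      obtain ⟨rfl, rfl⟩ := pair_inj.1 hat
      obtain ⟨rfl, rfl⟩ := pair_inj.1 hbt
      rcases (hs_lt ha hb hsub).eq_or_lt with rfl | hab
      · exact .inl rfl
      · exact .inr (vonNeumann_mem_of_lt hab)
  obtain ⟨f, hf, hfc, hfmono⟩ := (realize_chainRankedF hκ).1
    ((he.realize_iff hlt.le chainRankedF fun _ ↦ ⟨c, hc_rank⟩).2 hγc)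
  have hrank (a : Ordinal) : a < κ → ∀ v, pair (s a) v ∈ f → a ≤ v.rank := by
    induction a using WellFoundedLT.induction with
    | ind a ih =>
    intro ha v hv
    refine le_of_forall_lt fun b hb ↦ ?_
    obtain ⟨w, hw⟩ := hfc (s b) (hc.2 ⟨b, hb.trans ha, rfl⟩)
    refine (ih b hb (hb.trans ha) w hw).trans_lt ?_
    rcases hfmono _ _ _ _ hw hv (hs_mono hb.le) with h | h
    · exact absurd (hs_lt ha (hb.trans ha) h.ge) hb.not_ge
    · exact rank_lt_of_mem h
  obtain ⟨v, hv⟩ := hfc (s f.rank) (hc.2 ⟨_, hf, rfl⟩)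
  exact (hrank _ hf v hv).not_gt (rank_lt_of_pair_mem hv).2

theorem realize_enumerableF_of_card_lt (hκ : IsSuccPrelimit κ) {v : Empty → Vt κ}
    {xs : Fin 1 → Vt κ} (h : (xs 0).1.card < κ.card) : enumerableF.Realize v xs := by
  obtain ⟨x, hx⟩ : ∃ x, (xs 0).1 = x := ⟨_, rfl⟩
  have hxκ : x.rank < κ := hx ▸ (xs 0).2
  rw [realize_enumerableF hκ]
  rw [hx] at h ⊢
  have hord : x.card.ord < κ := (Cardinal.ord_lt_ord.2 h).trans_le (Cardinal.ord_card_le κ)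
  have hmk : Cardinal.mk x = Cardinal.mk (Set.Iio x.card.ord) := by
    rw [cardinalMk_coe_sort, Cardinal.mk_Iio_ordinal, Cardinal.card_ord]
  obtain ⟨e⟩ := Cardinal.eq.1 hmk
  let f : ZFSet := pairSep (fun w a ↦ ∃ hw : w ∈ x, a = V_ (e ⟨w, hw⟩)) x (V_ x.card.ord)
  have hf {w a : ZFSet} : pair w a ∈ f ↔ ∃ hw : w ∈ x, a = V_ (e ⟨w, hw⟩) := by
    simp only [f, mem_pairSep]
    constructor
    · rintro ⟨w', -, a', -, h, hwa⟩
      obtain ⟨rfl, rfl⟩ := pair_inj.1 h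
      exact hwa
    · rintro ⟨hw, rfl⟩
      exact ⟨w, hw, _, vonNeumann_mem_of_lt (e ⟨w, hw⟩).2, rfl, hw, rfl⟩
  refine ⟨f, ?_, fun w hw ↦ ⟨_, hf.2 ⟨hw, rfl⟩⟩, fun w a w' a' hwa hwa' ↦ ?_⟩
  · refine (rank_mono sep_subset).trans_lt ?_
    rw [rank_powerset, rank_powerset, rank_union, rank_vonNeumann]
    exact hκ.succ_lt (hκ.succ_lt (max_lt hxκ hord))
  · obtain ⟨hw, rfl⟩ := hf.1 hwa
    obtain ⟨hw', rfl⟩ := hf.1 hwa'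
    simp only [vonNeumann_mem_vonNeumann_iff]
    rcases lt_trichotomy (e ⟨w, hw⟩) (e ⟨w', hw'⟩) with h | h | h
    · exact .inr (.inl h)
    · exact .inl (Subtype.ext_iff.1 (e.injective h))
    · exact .inr (.inr h)

theorem exists_lt_card_le_of_realize_enumerableF (hκ : IsSuccPrelimit κ) {v : Empty → Vt κ}
    {xs : Fin 1 → Vt κ} (h : enumerableF.Realize v xs) :
    ∃ o < κ, (xs 0).1.card ≤ o.card := by
  obtain ⟨f, hf, hfx, hfinj⟩ := (realize_enumerableF hκ).1 h
  choose! g hg using hfx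
  have hrank (s : (xs 0).1) : (g s).rank < f.rank := (rank_lt_of_pair_mem (hg s s.2)).2
  refine ⟨f.rank, hf, ?_⟩
  rw [← Cardinal.lift_le.{1}, ← Cardinal.mk_Iio_ordinal, ← cardinalMk_coe_sort]
  refine Cardinal.mk_le_of_injective (f := fun s ↦ ⟨(g s).rank, hrank s⟩) fun s t hst ↦ ?_
  have hst : (g s).rank = (g t).rank := Subtype.ext_iff.1 hst
  rcases hfinj _ _ _ _ (hg s s.2) (hg t t.2) with h | h | h
  · exact Subtype.ext h
  · exact absurd hst (rank_lt_of_mem h).ne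
  · exact absurd hst (rank_lt_of_mem h).ne'

theorem VElem.card_lt_right (he : VElem κ γ) (hlt : κ < γ) (hx : x.rank < γ) :
    x.card < γ.card := by
  have hκ := he.isSuccPrelimit_left hlt
  have hγ := he.isSuccPrelimit_right hlt
  have h := (he.realize_iff hlt.le enumerableF.all default).1
    (BoundedFormula.realize_all.2 fun y ↦ realize_enumerableF_of_card_lt hκ (he.card_lt hlt y.2))
  have hp : x.powerset.rank < γ := by
    rw [rank_powerset]
    exact hγ.succ_lt hx
  obtain ⟨o, ho, hle⟩ := exists_lt_card_le_of_realize_enumerableF hγ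
    (BoundedFormula.realize_all.1 h ⟨x.powerset, hp⟩)
  change x.powerset.card ≤ o.card at hle
  rw [card_powerset] at hle
  exact (Cardinal.cantor _).trans_le (hle.trans (Ordinal.card_le_card ho.le))

end Elementarity

section BethFixed

variable {κ : Ordinal.{0}}

theorem ord_card_eq_of_forall_card_lt (h : ∀ x : ZFSet.{0}, x.rank < κ → x.card < κ.card) :
    κ.card.ord = κ := by
  refine (Cardinal.ord_card_le κ).antisymm (le_of_forall_lt fun a ha ↦ ?_)
  rw [Cardinal.lt_ord, ← Ordinal.card_toZFSet]
  exact h _ (by rwa [Ordinal.rank_toZFSet])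

theorem beth_eq_card_of_forall_card_lt (hκ : IsSuccPrelimit κ) (hω : ω < κ)
    (h : ∀ x : ZFSet.{0}, x.rank < κ → x.card < κ.card) : ℶ_ κ = κ.card := by
  have hord := ord_card_eq_of_forall_card_lt h
  refine le_antisymm ?_ (Ordinal.card_le_beth κ)
  rw [Cardinal.beth_limit ⟨not_isMin_of_lt hω, hκ⟩]
  refine ciSup_le' fun ⟨a, ha⟩ ↦ ?_
  have hprin : Ordinal.IsPrincipal (· + ·) κ := by
    rw [← hord]
    exact Ordinal.isPrincipal_add_ord (Ordinal.aleph0_le_card.2 hω.le)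
  rw [Cardinal.beth_eq_preBeth, ← card_vonNeumann]
  exact (h _ (by rw [rank_vonNeumann]; exact hprin hω ha)).le

theorem exists_mem_rank_eq_of_isTransitive {t : ZFSet} (ht : t.IsTransitive) {a : Ordinal}
    (ha : a < t.rank) : ∃ y ∈ t, y.rank = a := by
  obtain ⟨y, hy, hay⟩ := lt_rank_iff.1 ha
  induction y using ZFSet.inductionOn with
  | _ y ih =>
  rcases hay.eq_or_lt with rfl | hay
  · exact ⟨y, hy, rfl⟩
  · obtain ⟨z, hz, haz⟩ := lt_rank_iff.1 hay
    exact ih z hz (ht.subset_of_mem hy hz) haz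

theorem card_rank_le_of_isTransitive {t : ZFSet.{0}} (ht : t.IsTransitive) :
    t.rank.card ≤ t.card := by
  rw [← Cardinal.lift_le.{1}, ← Cardinal.mk_Iio_ordinal, ← cardinalMk_coe_sort]
  refine Cardinal.mk_le_of_surjective
    (f := fun y : t ↦ (⟨y.1.rank, rank_lt_of_mem y.2⟩ : Set.Iio t.rank)) fun ⟨a, ha⟩ ↦ ?_
  obtain ⟨y, hy, rfl⟩ := exists_mem_rank_eq_of_isTransitive ht ha
  exact ⟨⟨y, hy⟩, rfl⟩

theorem mem_HSet_iff {c : Cardinal.{0}} {x : ZFSet.{0}} :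
    x ∈ HSet c ↔ ∃ t : ZFSet, t.IsTransitive ∧ x ∈ t ∧ t.card < c := by
  have hcard (t : ZFSet.{0}) : Cardinal.mk.{1} t.toSet = Cardinal.lift.{1} t.card :=
    cardinalMk_coe_sort
  simp only [HSet, Set.mem_ofPred_eq, hcard, Cardinal.lift_lt]

theorem setOf_rank_lt_eq_HSet (hκ : IsSuccPrelimit κ)
    (h : ∀ x : ZFSet.{0}, x.rank < κ → x.card < κ.card) :
    {x : ZFSet.{0} | x.rank < κ} = HSet κ.card := by
  ext x
  rw [mem_HSet_iff, Set.mem_ofPred_eq]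
  constructor
  · intro hx
    exact ⟨V_ (succ x.rank), isTransitive_vonNeumann _, mem_vonNeumann_succ x,
      h _ (by rw [rank_vonNeumann]; exact hκ.succ_lt hx)⟩
  · rintro ⟨t, ht, hxt, htκ⟩
    refine (rank_lt_of_mem hxt).trans (lt_of_not_ge fun hle ↦ ?_)
    exact ((Ordinal.card_le_card hle).trans (card_rank_le_of_isTransitive ht)).not_gt htκ

theorem isInaccOrd_of_forall_card_lt (hκ : IsSuccPrelimit κ) (hω : ω < κ)
    (h : ∀ x : ZFSet.{0}, x.rank < κ → x.card < κ.card) (hreg : IsRegularOrd κ) :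
    IsInaccOrd κ := by
  refine ⟨Cardinal.isInaccessible_def.2 ⟨?_, hreg.1, ?_⟩, hreg.2⟩
  · simpa using h (Ordinal.toZFSet ω) (by rwa [Ordinal.rank_toZFSet])
  · rw [← beth_eq_card_of_forall_card_lt hκ hω h]
    exact Cardinal.isStrongLimit_beth.2 hκ

theorem isBethFixed_of_forall_card_lt (hκ : IsSuccPrelimit κ) (hω : ω < κ)
    (h : ∀ x : ZFSet.{0}, x.rank < κ → x.card < κ.card) : IsBethFixed κ := by
  rw [IsBethFixed, beth_eq_card_of_forall_card_lt hκ hω h, ord_card_eq_of_forall_card_lt h]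

end BethFixed

end Aux

/-- If `V_κ ≺ V_γ` is a proper elementary extension, then `κ` and `γ` are ℶ-fixed points,
`V_κ = H_κ` and `V_γ = H_γ`; in particular, if `κ` and `γ` are moreover regular cardinals,
then they are inaccessible. -/
theorem bethFixed_of_VElem (κ γ : Ordinal) (hlt : κ < γ) (he : VElem κ γ) :
    (IsBethFixed κ ∧ IsBethFixed γ) ∧
    ({x : ZFSet | x.rank < κ} = HSet κ.card ∧ {x : ZFSet | x.rank < γ} = HSet γ.card) ∧
    ((IsRegularOrd κ → IsInaccOrd κ) ∧ (IsRegularOrd γ → IsInaccOrd γ)) := by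
  have hω := he.omega0_lt hlt
  have hκ := he.isSuccPrelimit_left hlt
  have hγ := he.isSuccPrelimit_right hlt
  have hκcard (x : ZFSet) (hx : x.rank < κ) := he.card_lt hlt hx
  have hγcard (x : ZFSet) (hx : x.rank < γ) := he.card_lt_right hlt hx
  exact ⟨⟨isBethFixed_of_forall_card_lt hκ hω hκcard,
      isBethFixed_of_forall_card_lt hγ (hω.trans hlt) hγcard⟩,
    ⟨setOf_rank_lt_eq_HSet hκ hκcard, setOf_rank_lt_eq_HSet hγ hγcard⟩,
    isInaccOrd_of_forall_card_lt hκ hω hκcard,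
    isInaccOrd_of_forall_card_lt hγ (hω.trans hlt) hγcard⟩

end Paper
end
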